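/- Let F be a field and let T_1, T_2, …, and W_1, W_2, … be polynomials in F[t] satisfying T_1 = W_1 and, for every j ≥ 1, the recurrence T_{j+1} = (∏_{k=1}^{j} (T_k² − 1)·W_k)·W_{j+1}. If for some N ≥ 1 the polynomial T_N is a nonzero constant, then W_k is a constant for every k ≤ N, and T_k is a constant for every k ≤ N − 1. -/

import Mathlib

open Finset Polynomial

/-- If `T_1 = W_1` and `T_{j+1} = (∏_{k=1}^{j} (T_k² − 1)·W_k)·W_{j+1}` in
`F[t]`, and `T_N` is a nonzero constant for some `N ≥ 1`, then all `W_k` with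
`k ≤ N` are constants and all `T_k` with `k ≤ N − 1` are constants. -/
theorem chain_constants {F : Type*} [Field F]
    (T W : ℕ → Polynomial F)
    (hbase : T 1 = W 1)
    (hrec : ∀ j : ℕ, 1 ≤ j →
      T (j + 1) = (∏ k ∈ Finset.Icc 1 j, (T k ^ 2 - 1) * W k) * W (j + 1))
    (N : ℕ) (hN : 1 ≤ N)
    (hconst : ∃ c : F, c ≠ 0 ∧ T N = C c) :
    (∀ k : ℕ, 1 ≤ k → k ≤ N → ∃ c : F, W k = C c) ∧
    (∀ k : ℕ, 1 ≤ k → k ≤ N - 1 → ∃ c : F, T k = C c) := by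
  obtain ⟨c, hc, hT⟩ := hconst
  have hu : IsUnit (T N) := by
    rw [hT]; exact Polynomial.isUnit_C.mpr hc.isUnit
  have key : ∀ p : Polynomial F, IsUnit p → ∃ c : F, p = C c := by
    intro p hp
    obtain ⟨r, _, h⟩ := Polynomial.isUnit_iff.mp hp
    exact ⟨r, h.symm⟩
  obtain ⟨j, rfl⟩ : ∃ j, N = j + 1 := ⟨N - 1, by omega⟩
  rcases Nat.eq_zero_or_pos j with rfl | hj
  · refine ⟨?_, ?_⟩
    · intro k h1 h2
      obtain rfl : k = 1 := by omega
      exact ⟨c, by rw [← hbase]; exact hT⟩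
    · intro k h1 h2
      omega
  · rw [hrec j hj] at hu
    obtain ⟨hp, hw⟩ := IsUnit.mul_iff.mp hu
    have hf : ∀ k, 1 ≤ k → k ≤ j → IsUnit (T k ^ 2 - 1) ∧ IsUnit (W k) := by
      intro k h1 h2
      have hd : (T k ^ 2 - 1) * W k ∣ ∏ k ∈ Finset.Icc 1 j, (T k ^ 2 - 1) * W k :=
        Finset.dvd_prod_of_mem (fun k => (T k ^ 2 - 1) * W k) (Finset.mem_Icc.mpr ⟨h1, h2⟩)
      exact IsUnit.mul_iff.mp (isUnit_of_dvd_unit hd hp)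
    refine ⟨?_, ?_⟩
    · intro k h1 h2
      rcases Nat.lt_or_ge j k with h | h
      · obtain rfl : k = j + 1 := by omega
        exact key _ hw
      · exact key _ (hf k h1 h).2
    · intro k h1 h2
      obtain ⟨r, hr⟩ := key _ (hf k h1 (by omega)).1
      have h3 : T k ^ 2 = C (r + 1) := by
        rw [C_add, C_1, ← hr]; ring
      have h4 : (T k ^ 2).natDegree = 0 := by rw [h3, natDegree_C]
      rw [natDegree_pow] at h4
      exact ⟨(T k).coeff 0, eq_C_of_natDegree_eq_zero (by omega)⟩
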